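/- arXiv:2309.02661 — 2 statements merged into one kernel-verified Lean document; each statement's English description precedes it below -/
import Mathlib

section
/- Let θ > 0, δ > 0 and γ > 0. Suppose f : (0,∞) → [0,∞) is measurable, monotone on some interval (0,δ₀) with δ₀ > 0, and satisfies ∫_0^∞ e^{-sx} f(x) dx = 1/(1 + θδ(√(γ² + 2s) − γ)) for all s > 0. Then f(x) ∼ x^{-1/2}/(θδ√(2π)) as x → 0^+; that is, lim_{x→0^+} θδ √(2π) √x f(x) = 1. -/
open Real Filter MeasureTheory

/-- The integral of `f` over `(0, ∞)` against the weight `e^{-sx} g(e^{-sx})`; for `g = 1` this is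
the Laplace transform of `f` at `s`. -/
noncomputable def weightedLaplace (f g : ℝ → ℝ) (s : ℝ) : ℝ :=
  ∫ x in Set.Ioi (0 : ℝ), Real.exp (-s * x) * g (Real.exp (-s * x)) * f x

lemma exp_neg_mul_mem_Icc {s x : ℝ} (hs : 0 < s) (hx : 0 < x) :
    Real.exp (-s * x) ∈ Set.Icc (0 : ℝ) 1 :=
  ⟨(Real.exp_pos _).le, Real.exp_le_one_iff.2 (by nlinarith [mul_pos hs hx])⟩

lemma integrableOn_weightedLaplace {f g : ℝ → ℝ} {s : ℝ} (hs : 0 < s) (hg : Continuous g)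
    (hf : IntegrableOn (fun x => Real.exp (-s * x) * f x) (Set.Ioi 0)) :
    IntegrableOn (fun x => Real.exp (-s * x) * g (Real.exp (-s * x)) * f x) (Set.Ioi 0) := by
  obtain ⟨c, hc⟩ := isCompact_Icc.exists_bound_of_continuousOn
    (hg.continuousOn (s := Set.Icc (0 : ℝ) 1))
  have h : IntegrableOn (fun x => g (Real.exp (-s * x)) * (Real.exp (-s * x) * f x))
      (Set.Ioi 0) := by
    refine Integrable.bdd_mul (c := c) hf
      (by fun_prop : Continuous fun x => g (Real.exp (-s * x))).aestronglyMeasurable ?_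
    filter_upwards [ae_restrict_mem measurableSet_Ioi] with x hx
    exact hc _ (exp_neg_mul_mem_Icc hs hx)
  exact h.congr_fun (fun x _ => by ring) measurableSet_Ioi

lemma weightedLaplace_mono {f₁ f₂ g : ℝ → ℝ} {s : ℝ} (hs : 0 < s) (hg : Continuous g)
    (hg0 : ∀ y, 0 ≤ g y)
    (hf₁ : IntegrableOn (fun x => Real.exp (-s * x) * f₁ x) (Set.Ioi 0))
    (hf₂ : IntegrableOn (fun x => Real.exp (-s * x) * f₂ x) (Set.Ioi 0))
    (h : ∀ x > 0, g (Real.exp (-s * x)) ≠ 0 → f₁ x ≤ f₂ x) :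
    weightedLaplace f₁ g s ≤ weightedLaplace f₂ g s := by
  refine setIntegral_mono_on (integrableOn_weightedLaplace hs hg hf₁)
    (integrableOn_weightedLaplace hs hg hf₂) measurableSet_Ioi fun x hx => ?_
  by_cases h0 : g (Real.exp (-s * x)) = 0
  · rw [h0, mul_zero, zero_mul, zero_mul]
  · exact mul_le_mul_of_nonneg_left (h x hx h0) (mul_nonneg (Real.exp_pos _).le (hg0 _))

lemma weightedLaplace_const_mul (c : ℝ) (f g : ℝ → ℝ) (s : ℝ) :
    weightedLaplace (fun x => c * f x) g s = c * weightedLaplace f g s := by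
  rw [weightedLaplace, weightedLaplace, ← integral_const_mul]
  exact integral_congr_ae (.of_forall fun x => by ring)

lemma weightedLaplace_one_eq_inv_mul (g : ℝ → ℝ) {s : ℝ} (hs : 0 < s) :
    weightedLaplace 1 g s = s⁻¹ * weightedLaplace 1 g 1 := by
  have h := integral_comp_mul_left_Ioi
    (fun x => Real.exp (-x) * g (Real.exp (-x))) 0 hs
  simpa [weightedLaplace] using h

lemma abs_weightedLaplace_sub_le {f g p : ℝ → ℝ} {s ε : ℝ} (hs : 0 < s) (hg : Continuous g)
    (hp : Continuous p) (hf0 : ∀ x > 0, 0 ≤ f x)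
    (hf : IntegrableOn (fun x => Real.exp (-s * x) * f x) (Set.Ioi 0))
    (h : ∀ y ∈ Set.Icc (0 : ℝ) 1, |p y - g y| ≤ ε) :
    |weightedLaplace f p s - weightedLaplace f g s| ≤ ε * weightedLaplace f 1 s := by
  have e : ε * weightedLaplace f 1 s
      = ∫ x in Set.Ioi (0 : ℝ), ε * (Real.exp (-s * x) * f x) := by
    simp [weightedLaplace, integral_const_mul]
  rw [e, weightedLaplace, weightedLaplace, ← integral_sub (integrableOn_weightedLaplace hs hp hf)
    (integrableOn_weightedLaplace hs hg hf), ← Real.norm_eq_abs]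
  refine norm_integral_le_of_norm_le (hf.const_mul ε) ?_
  filter_upwards [ae_restrict_mem measurableSet_Ioi] with x hx
  have h0 : 0 ≤ Real.exp (-s * x) * f x := mul_nonneg (Real.exp_pos _).le (hf0 x hx)
  rw [show Real.exp (-s * x) * p (Real.exp (-s * x)) * f x
      - Real.exp (-s * x) * g (Real.exp (-s * x)) * f x
      = (p (Real.exp (-s * x)) - g (Real.exp (-s * x))) * (Real.exp (-s * x) * f x) by ring,
    norm_mul, Real.norm_eq_abs, Real.norm_of_nonneg h0]
  exact mul_le_mul_of_nonneg_right (h _ (exp_neg_mul_mem_Icc hs hx)) h0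

lemma weightedLaplace_monomial (f : ℝ → ℝ) (n : ℕ) (a s : ℝ) :
    weightedLaplace f (fun y => (Polynomial.monomial n a).eval y) s
      = a * weightedLaplace f 1 ((n + 1) * s) := by
  rw [weightedLaplace, weightedLaplace, ← integral_const_mul]
  refine integral_congr_ae (.of_forall fun x => ?_)
  have h : Real.exp (-((n + 1) * s) * x) = Real.exp (-s * x) * Real.exp (-s * x) ^ n := by
    rw [← Real.exp_nat_mul, ← Real.exp_add]
    congr 1
    ring
  simp only [Polynomial.eval_monomial, Pi.one_apply, h]
  ring

lemma weightedLaplace_add {f g₁ g₂ : ℝ → ℝ} {s : ℝ} (hs : 0 < s) (hg₁ : Continuous g₁)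
    (hg₂ : Continuous g₂) (hf : IntegrableOn (fun x => Real.exp (-s * x) * f x) (Set.Ioi 0)) :
    weightedLaplace f (fun y => g₁ y + g₂ y) s
      = weightedLaplace f g₁ s + weightedLaplace f g₂ s := by
  rw [weightedLaplace, weightedLaplace, weightedLaplace, ← integral_add
    (integrableOn_weightedLaplace hs hg₁ hf) (integrableOn_weightedLaplace hs hg₂ hf)]
  exact integral_congr_ae (.of_forall fun x => by ring)

lemma integrableOn_exp_neg_mul_rpow {ρ s : ℝ} (hρ : 0 < ρ) (hs : 0 < s) :
    IntegrableOn (fun x : ℝ => Real.exp (-s * x) * x ^ (ρ - 1)) (Set.Ioi 0) :=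
  (integrableOn_rpow_mul_exp_neg_mul_rpow (p := 1) (s := ρ - 1) (by linarith) one_pos hs).congr_fun
    (fun x _ => by simp [mul_comm]) measurableSet_Ioi

lemma weightedLaplace_rpow {ρ s : ℝ} (hρ : 0 < ρ) (hs : 0 < s) :
    weightedLaplace (fun x => x ^ (ρ - 1)) 1 s = (1 / s) ^ ρ * Real.Gamma ρ := by
  rw [← Real.integral_rpow_mul_exp_neg_mul_Ioi hρ hs, weightedLaplace]
  exact integral_congr_ae (.of_forall fun x => by simp [mul_comm])

/-- **Karamata's theorem** for continuous weights. -/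
theorem tendsto_rpow_mul_weightedLaplace {f g : ℝ → ℝ} {ρ C : ℝ} (hρ : 0 < ρ)
    (hf0 : ∀ x > 0, 0 ≤ f x)
    (hf : ∀ s > 0, IntegrableOn (fun x => Real.exp (-s * x) * f x) (Set.Ioi 0))
    (hlim : Tendsto (fun s => s ^ ρ * weightedLaplace f 1 s) atTop (nhds (C * Real.Gamma ρ)))
    (hg : Continuous g) :
    Tendsto (fun s => s ^ ρ * weightedLaplace f g s) atTop
      (nhds (C * weightedLaplace (fun x => x ^ (ρ - 1)) g 1)) := by
  have hpoly : ∀ p : Polynomial ℝ, Tendsto (fun s => s ^ ρ * weightedLaplace f (p.eval ·) s) atTop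
      (nhds (C * weightedLaplace (fun x => x ^ (ρ - 1)) (p.eval ·) 1)) := by
    intro p
    induction p using Polynomial.induction_on' with
    | add p q hp hq =>
      simp only [Polynomial.eval_add]
      rw [weightedLaplace_add one_pos p.continuous q.continuous
        (integrableOn_exp_neg_mul_rpow hρ one_pos), mul_add]
      refine (hp.add hq).congr' ?_
      filter_upwards [eventually_gt_atTop 0] with s hs
      rw [weightedLaplace_add hs p.continuous q.continuous (hf s hs), mul_add]
    | monomial n a =>
      have hn : (0 : ℝ) < n + 1 := by positivity
      have h := (hlim.comp (tendsto_id.const_mul_atTop hn)).const_mul (a * (1 / (n + 1)) ^ ρ)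
      rw [weightedLaplace_monomial, weightedLaplace_rpow hρ (by positivity)]
      convert h.congr' ?_ using 2
      · rw [mul_one]
        ring
      · filter_upwards [eventually_gt_atTop 0] with s hs
        rw [weightedLaplace_monomial]
        simp only [Function.comp_apply, id]
        rw [Real.mul_rpow hn.le hs.le, Real.div_rpow zero_le_one hn.le, Real.one_rpow]
        have := (Real.rpow_pos_of_pos hn ρ).ne'
        field_simp
  have hM := hpoly 1
  have hone : ((fun y => (1 : Polynomial ℝ).eval y) : ℝ → ℝ) = 1 := by
    ext y
    simp
  rw [hone] at hM
  set M := weightedLaplace (fun x => x ^ (ρ - 1)) 1 1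
  have hM0 : 0 ≤ M := by
    refine setIntegral_nonneg measurableSet_Ioi fun x (hx : 0 < x) => ?_
    simp only [Pi.one_apply]
    positivity
  rw [Metric.tendsto_nhds]
  intro η hη
  have hD : 0 < 2 * |C| * M + 2 := by positivity
  set ε := η / (2 * |C| * M + 2) with hε_def
  have hε : 0 < ε := by positivity
  obtain ⟨p, hp⟩ := exists_polynomial_near_of_continuousOn 0 1 g hg.continuousOn ε hε
  have hp' : ∀ y ∈ Set.Icc (0 : ℝ) 1, |p.eval y - g y| ≤ ε := fun y hy => (hp y hy).le
  have hlimit := abs_weightedLaplace_sub_le one_pos hg p.continuous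
    (fun x (hx : 0 < x) => (Real.rpow_pos_of_pos hx (ρ - 1)).le)
    (integrableOn_exp_neg_mul_rpow hρ one_pos) hp'
  filter_upwards [eventually_gt_atTop 0, (Metric.tendsto_nhds.1 (hpoly p)) ε hε,
    hM.eventually_lt_const (show C * M < |C| * M + 1 by nlinarith [le_abs_self C])] with s hs h1 h2
  have hsρ := Real.rpow_pos_of_pos hs ρ
  have h3 := mul_le_mul_of_nonneg_left
    (abs_weightedLaplace_sub_le hs hg p.continuous hf0 (hf s hs) hp') hsρ.le
  have h4 := mul_le_mul_of_nonneg_left hlimit (abs_nonneg C)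
  rw [← abs_of_pos hsρ, ← abs_mul, abs_of_pos hsρ, mul_sub] at h3
  rw [← abs_mul, mul_sub] at h4
  rw [Real.dist_eq] at h1 ⊢
  have h5 : s ^ ρ * (ε * weightedLaplace f 1 s) < ε * (|C| * M + 1) := by
    rw [mul_left_comm]
    exact mul_lt_mul_of_pos_left h2 hε
  have h6 : ε * (2 * |C| * M + 2) = η := div_mul_cancel₀ _ hD.ne'
  rw [abs_le] at h3 h4
  rw [abs_lt] at h1 ⊢
  constructor <;> nlinarith

/-- A tent function supported in `[e^{-r}, e^{-1}]`. -/
noncomputable def expTent (r y : ℝ) : ℝ :=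
  max 0 (min (y - Real.exp (-r)) (Real.exp (-1) - y))

lemma continuous_expTent (r : ℝ) : Continuous (expTent r) := by
  unfold expTent
  fun_prop

lemma expTent_nonneg (r y : ℝ) : 0 ≤ expTent r y := le_max_left _ _

lemma expTent_exp_ne_zero_iff {r u : ℝ} : expTent r (Real.exp (-u)) ≠ 0 ↔ 1 < u ∧ u < r := by
  rw [(expTent_nonneg r _).lt_iff_ne'.symm, expTent, lt_max_iff, lt_min_iff, sub_pos, sub_pos,
    Real.exp_lt_exp, Real.exp_lt_exp]
  simp [and_comm]

lemma integrableOn_exp_neg_mul_const {s : ℝ} (hs : 0 < s) (c : ℝ) :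
    IntegrableOn (fun x => Real.exp (-s * x) * (c * (1 : ℝ → ℝ) x)) (Set.Ioi 0) :=
  (integrableOn_exp_mul_Ioi (neg_lt_zero.2 hs) 0).mul_const (c * 1)

lemma weightedLaplace_one_expTent_pos {r : ℝ} (hr : 1 < r) :
    0 < weightedLaplace 1 (expTent r) 1 := by
  have hint := integrableOn_weightedLaplace (f := 1) one_pos (continuous_expTent r)
    (by simpa using integrableOn_exp_neg_mul_const one_pos 1)
  rw [weightedLaplace, setIntegral_pos_iff_support_of_nonneg_ae _ hint]
  · refine (isOpen_Ioo.measure_pos volume (Set.nonempty_Ioo.2 hr)).trans_le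
      (measure_mono fun u hu => ⟨?_, zero_lt_one.trans hu.1⟩)
    have := expTent_exp_ne_zero_iff.2 hu
    simpa [Function.mem_support] using this
  · exact .of_forall fun x =>
      mul_nonneg (mul_nonneg (Real.exp_pos _).le (expTent_nonneg _ _)) zero_le_one

/-- The mean of `x ^ (ρ - 1)` with respect to the tent weight. -/
noncomputable def tentMean (ρ r : ℝ) : ℝ :=
  weightedLaplace (fun x => x ^ (ρ - 1)) (expTent r) 1 / weightedLaplace 1 (expTent r) 1

lemma tentMean_mem_Icc {ρ r : ℝ} (hρ : 0 < ρ) (hr : 1 < r) :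
    tentMean ρ r ∈ Set.Icc r⁻¹ (r ^ ρ) := by
  have hr0 : 0 < r := by linarith
  have key : ∀ x > 0, expTent r (Real.exp (-1 * x)) ≠ 0 →
      r⁻¹ * (1 : ℝ → ℝ) x ≤ x ^ (ρ - 1) ∧ x ^ (ρ - 1) ≤ r ^ ρ * (1 : ℝ → ℝ) x := by
    intro x hx h
    rw [neg_one_mul, expTent_exp_ne_zero_iff] at h
    simp only [Pi.one_apply, mul_one]
    rw [Real.rpow_sub_one hx.ne', inv_eq_one_div]
    have h1 : 1 ≤ x ^ ρ := Real.one_le_rpow h.1.le hρ.le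
    have h2 : x ^ ρ ≤ r ^ ρ := Real.rpow_le_rpow hx.le h.2.le hρ.le
    exact ⟨div_le_div₀ (by linarith) h1 hx h.2.le,
      (div_le_self (by linarith) h.1.le).trans h2⟩
  rw [tentMean, Set.mem_Icc, le_div_iff₀ (weightedLaplace_one_expTent_pos hr),
    div_le_iff₀ (weightedLaplace_one_expTent_pos hr), ← weightedLaplace_const_mul,
    ← weightedLaplace_const_mul]
  exact ⟨weightedLaplace_mono one_pos (continuous_expTent r) (expTent_nonneg r)
      (integrableOn_exp_neg_mul_const one_pos _) (integrableOn_exp_neg_mul_rpow hρ one_pos)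
      fun x hx h => (key x hx h).1,
    weightedLaplace_mono one_pos (continuous_expTent r) (expTent_nonneg r)
      (integrableOn_exp_neg_mul_rpow hρ one_pos) (integrableOn_exp_neg_mul_const one_pos _)
      fun x hx h => (key x hx h).2⟩

/-- `x ^ (1 - ρ)` times the tent-weighted mean of `f` over `[x / k, r x / k]`. -/
noncomputable def localMean (f : ℝ → ℝ) (ρ r k x : ℝ) : ℝ :=
  x ^ (1 - ρ) * (weightedLaplace f (expTent r) (k / x) / weightedLaplace 1 (expTent r) (k / x))

section LocalMean

variable {f : ℝ → ℝ} {ρ C r k x : ℝ}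

lemma localMean_le (hr : 1 < r) (hk : 0 < k) (hx : 0 < x)
    (hf : ∀ s > 0, IntegrableOn (fun x => Real.exp (-s * x) * f x) (Set.Ioi 0))
    (h : ∀ y, x / k < y → y < r * x / k → f y ≤ f x) :
    localMean f ρ r k x ≤ x ^ (1 - ρ) * f x := by
  have hs : 0 < k / x := by positivity
  refine mul_le_mul_of_nonneg_left ?_ (Real.rpow_nonneg hx.le _)
  have hpos : 0 < weightedLaplace 1 (expTent r) (k / x) := by
    rw [weightedLaplace_one_eq_inv_mul _ hs]
    have := weightedLaplace_one_expTent_pos hr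
    positivity
  rw [div_le_iff₀ hpos, ← weightedLaplace_const_mul]
  refine weightedLaplace_mono hs (continuous_expTent r) (expTent_nonneg r) (hf _ hs)
    (integrableOn_exp_neg_mul_const hs _) fun y hy hy' => ?_
  rw [neg_mul, expTent_exp_ne_zero_iff, div_mul_eq_mul_div, lt_div_iff₀ hx, div_lt_iff₀ hx] at hy'
  simp only [Pi.one_apply, mul_one]
  refine h y ?_ ?_
  · rw [div_lt_iff₀ hk]
    linarith
  · rw [lt_div_iff₀ hk]
    linarith

lemma le_localMean (hr : 1 < r) (hk : 0 < k) (hx : 0 < x)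
    (hf : ∀ s > 0, IntegrableOn (fun x => Real.exp (-s * x) * f x) (Set.Ioi 0))
    (h : ∀ y, x / k < y → y < r * x / k → f x ≤ f y) :
    x ^ (1 - ρ) * f x ≤ localMean f ρ r k x := by
  have hneg : ∀ s, weightedLaplace (fun y => -f y) (expTent r) s
      = -weightedLaplace f (expTent r) s := fun s => by
    simpa using weightedLaplace_const_mul (-1) f (expTent r) s
  have := localMean_le (f := fun y => -f y) (ρ := ρ) hr hk hx
    (fun s hs => by simpa using (hf s hs).neg) fun y h1 h2 => neg_le_neg (h y h1 h2)
  rw [localMean, hneg, neg_div, mul_neg, mul_neg, neg_le_neg_iff] at this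
  exact this

lemma tendsto_localMean (hρ : 0 < ρ) (hr : 1 < r) (hk : 0 < k)
    (hf0 : ∀ x > 0, 0 ≤ f x)
    (hf : ∀ s > 0, IntegrableOn (fun x => Real.exp (-s * x) * f x) (Set.Ioi 0))
    (hlim : Tendsto (fun s => s ^ ρ * weightedLaplace f 1 s) atTop (nhds (C * Real.Gamma ρ))) :
    Tendsto (localMean f ρ r k) (nhdsWithin 0 (Set.Ioi 0))
      (nhds (C * (k ^ (1 - ρ) * tentMean ρ r))) := by
  have hpos := weightedLaplace_one_expTent_pos hr
  have hk' : Tendsto (fun x : ℝ => k / x) (nhdsWithin 0 (Set.Ioi 0)) atTop :=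
    tendsto_inv_nhdsGT_zero.const_mul_atTop hk
  have h := ((tendsto_rpow_mul_weightedLaplace hρ hf0 hf hlim
    (continuous_expTent r)).comp hk').const_mul (k ^ (1 - ρ) / weightedLaplace 1 (expTent r) 1)
  convert h.congr' ?_ using 2
  · rw [tentMean]
    ring
  · filter_upwards [self_mem_nhdsWithin] with x (hx : 0 < x)
    rw [localMean, weightedLaplace_one_eq_inv_mul _ (show 0 < k / x by positivity),
      Function.comp_apply, Real.div_rpow hk.le hx.le, Real.rpow_sub hk, Real.rpow_sub hx,
      Real.rpow_one, Real.rpow_one]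
    have := (Real.rpow_pos_of_pos hk ρ).ne'
    have := (Real.rpow_pos_of_pos hx ρ).ne'
    field_simp

end LocalMean

/-- The **monotone density theorem** at `0⁺` combined with Karamata's Tauberian theorem. -/
theorem tendsto_rpow_mul_of_tendsto_laplace {f : ℝ → ℝ} {ρ C : ℝ} (hρ : 0 < ρ)
    (hf0 : ∀ x > 0, 0 ≤ f x)
    (hf : ∀ s > 0, IntegrableOn (fun x => Real.exp (-s * x) * f x) (Set.Ioi 0))
    (hmono : ∃ δ₀ > (0 : ℝ), MonotoneOn f (Set.Ioo 0 δ₀) ∨ AntitoneOn f (Set.Ioo 0 δ₀))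
    (hlim : Tendsto (fun s => s ^ ρ * weightedLaplace f 1 s) atTop (nhds (C * Real.Gamma ρ))) :
    Tendsto (fun x => x ^ (1 - ρ) * f x) (nhdsWithin 0 (Set.Ioi 0)) (nhds C) := by
  obtain ⟨δ₀, hδ₀, hmono⟩ := hmono
  have hmean : Tendsto (tentMean ρ) (nhdsWithin 1 (Set.Ioi 1)) (nhds 1) := by
    refine tendsto_of_tendsto_of_tendsto_of_le_of_le' (g := fun r : ℝ => r⁻¹)
      (h := fun r : ℝ => r ^ ρ) ?_ ?_ ?_ ?_
    · exact (tendsto_inv₀ one_ne_zero).mono_left nhdsWithin_le_nhds |>.trans (by simp)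
    · have := (Real.continuousAt_rpow_const 1 ρ (Or.inr hρ.le)).tendsto
      rw [Real.one_rpow] at this
      exact this.mono_left nhdsWithin_le_nhds
    · filter_upwards [self_mem_nhdsWithin] with r hr using (tentMean_mem_Icc hρ hr).1
    · filter_upwards [self_mem_nhdsWithin] with r hr using (tentMean_mem_Icc hρ hr).2
  have hpow : Tendsto (fun r : ℝ => r ^ (1 - ρ)) (nhdsWithin 1 (Set.Ioi 1)) (nhds 1) := by
    have := (Real.continuousAt_rpow_const 1 (1 - ρ) (Or.inl one_ne_zero)).tendsto
    rw [Real.one_rpow] at this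
    exact this.mono_left nhdsWithin_le_nhds
  have hlim_one : Tendsto (fun r => C * ((1 : ℝ) ^ (1 - ρ) * tentMean ρ r))
      (nhdsWithin 1 (Set.Ioi 1)) (nhds C) := by
    simpa using hmean.const_mul C
  have hlim_self : Tendsto (fun r => C * (r ^ (1 - ρ) * tentMean ρ r))
      (nhdsWithin 1 (Set.Ioi 1)) (nhds C) := by
    simpa using (hpow.mul hmean).const_mul C
  have near : ∀ r > (1 : ℝ), ∀ᶠ x in nhdsWithin (0 : ℝ) (Set.Ioi 0), 0 < x ∧ r * x < δ₀ := by
    intro r hr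
    filter_upwards [Ioo_mem_nhdsGT (show 0 < δ₀ / r by positivity)] with x hx
    exact ⟨hx.1, by rw [mul_comm]; exact (lt_div_iff₀ (by linarith)).1 hx.2⟩
  have above : ∀ r > (1 : ℝ), ∀ x > 0, r * x < δ₀ → ∀ y, x / 1 < y → y < r * x / 1 →
      x ≤ y ∧ x ∈ Set.Ioo 0 δ₀ ∧ y ∈ Set.Ioo 0 δ₀ := by
    intro r hr x hx hxr y h1 h2
    rw [div_one] at h1 h2
    exact ⟨h1.le, ⟨hx, by linarith⟩, by linarith, by linarith⟩
  have below : ∀ r > (1 : ℝ), ∀ x > 0, r * x < δ₀ → ∀ y, x / r < y → y < r * x / r →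
      y ≤ x ∧ x ∈ Set.Ioo 0 δ₀ ∧ y ∈ Set.Ioo 0 δ₀ := by
    intro r hr x hx hxr y h1 h2
    have hr0 : 0 < r := by linarith
    rw [mul_div_cancel_left₀ _ hr0.ne'] at h2
    have hxδ : x < δ₀ := by nlinarith
    exact ⟨h2.le, ⟨hx, hxδ⟩, (div_pos hx hr0).trans h1, by linarith⟩
  have hk := fun r (hr : r ∈ Set.Ioi (1 : ℝ)) k (hk : 0 < k) =>
    tendsto_localMean (C := C) hρ hr hk hf0 hf hlim
  -- It is enough to bound `x ^ (1 - ρ) * f x` by local means to the left and right of `x`.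
  have squeeze : ∀ a b : ℝ → ℝ, (∀ r > 1, 0 < a r) → (∀ r > 1, 0 < b r) →
      Tendsto (fun r => C * (a r ^ (1 - ρ) * tentMean ρ r)) (nhdsWithin 1 (Set.Ioi 1)) (nhds C) →
      Tendsto (fun r => C * (b r ^ (1 - ρ) * tentMean ρ r)) (nhdsWithin 1 (Set.Ioi 1)) (nhds C) →
      (∀ r > 1, ∀ x > 0, r * x < δ₀ → localMean f ρ r (a r) x ≤ x ^ (1 - ρ) * f x) →
      (∀ r > 1, ∀ x > 0, r * x < δ₀ → x ^ (1 - ρ) * f x ≤ localMean f ρ r (b r) x) →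
      Tendsto (fun x => x ^ (1 - ρ) * f x) (nhdsWithin 0 (Set.Ioi 0)) (nhds C) := by
    intro a b ha hb hla hlb hlow hupp
    rw [tendsto_order]
    constructor
    · intro c hc
      obtain ⟨r, hcr, hr⟩ := ((hla.eventually_const_lt hc).and self_mem_nhdsWithin).exists
      filter_upwards [(hk r hr _ (ha r hr)).eventually_const_lt hcr, near r hr] with x h1 h2
      exact h1.trans_le (hlow r hr x h2.1 h2.2)
    · intro c hc
      obtain ⟨r, hcr, hr⟩ := ((hlb.eventually_lt_const hc).and self_mem_nhdsWithin).exists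
      filter_upwards [(hk r hr _ (hb r hr)).eventually_lt_const hcr, near r hr] with x h1 h2
      exact (hupp r hr x h2.1 h2.2).trans_lt h1
  have hpos : ∀ r > (1 : ℝ), 0 < r := fun r hr => zero_lt_one.trans hr
  rcases hmono with hm | hm
  · refine squeeze (fun r => r) (fun _ => 1) hpos (fun _ _ => one_pos) hlim_self hlim_one ?_ ?_
    · intro r hr x hx hxr
      refine localMean_le hr (hpos r hr) hx hf fun y h1 h2 => ?_
      obtain ⟨h, hx', hy'⟩ := below r hr x hx hxr y h1 h2
      exact hm hy' hx' h
    · intro r hr x hx hxr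
      refine le_localMean hr one_pos hx hf fun y h1 h2 => ?_
      obtain ⟨h, hx', hy'⟩ := above r hr x hx hxr y h1 h2
      exact hm hx' hy' h
  · refine squeeze (fun _ => 1) (fun r => r) (fun _ _ => one_pos) hpos hlim_one hlim_self ?_ ?_
    · intro r hr x hx hxr
      refine localMean_le hr one_pos hx hf fun y h1 h2 => ?_
      obtain ⟨h, hx', hy'⟩ := above r hr x hx hxr y h1 h2
      exact hm hx' hy' h
    · intro r hr x hx hxr
      refine le_localMean hr (hpos r hr) hx hf fun y h1 h2 => ?_
      obtain ⟨h, hx', hy'⟩ := below r hr x hx hxr y h1 h2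
      exact hm hy' hx' h

lemma tendsto_sqrt_mul_geometric_inverse_gaussian_laplace {c : ℝ} (γ : ℝ) (hc : 0 < c) :
    Tendsto (fun s => √s * (1 / (1 + c * (√(γ ^ 2 + 2 * s) - γ)))) atTop
      (nhds (1 / (c * √2))) := by
  have hsqrt : Tendsto (fun s : ℝ => (1 - c * γ) / √s) atTop (nhds 0) :=
    tendsto_sqrt_atTop.const_div_atTop _
  have hin : Tendsto (fun s : ℝ => √(γ ^ 2 / s + 2)) atTop (nhds (√2)) := by
    have := ((tendsto_id (α := ℝ) (x := atTop)).const_div_atTop (γ ^ 2)).add_const 2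
    rw [zero_add] at this
    exact this.sqrt
  have hlim := (hsqrt.add (hin.const_mul c)).inv₀ (by positivity)
  rw [zero_add] at hlim
  rw [one_div]
  refine hlim.congr' ?_
  filter_upwards [eventually_gt_atTop 0] with s hs
  have hs' : 0 < √s := Real.sqrt_pos.2 hs
  have h : √(γ ^ 2 + 2 * s) = √s * √(γ ^ 2 / s + 2) := by
    rw [← Real.sqrt_mul hs.le]
    congr 1
    field_simp
  have h' : 1 + c * (√(γ ^ 2 + 2 * s) - γ) = √s * ((1 - c * γ) / √s + c * √(γ ^ 2 / s + 2)) := by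
    rw [h]
    field_simp
    ring
  rw [h', one_div, mul_inv, mul_inv_cancel_left₀ hs'.ne']

/-- Tauberian asymptotics at `0⁺` for a density with geometric inverse Gaussian Laplace
transform: `f(x) ∼ x^(-1/2)/(θδ√(2π))` as `x → 0⁺`. -/
theorem geometric_inverse_gaussian_density_asymp
    (θ δ γ : ℝ) (hθ : 0 < θ) (hδ : 0 < δ) (hγ : 0 < γ)
    (f : ℝ → ℝ) (hfmeas : Measurable f) (hfnn : ∀ x > 0, 0 ≤ f x)
    (hfmono : ∃ δ₀ > (0 : ℝ), MonotoneOn f (Set.Ioo 0 δ₀) ∨ AntitoneOn f (Set.Ioo 0 δ₀))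
    (hLap : ∀ s > 0, ∫ x in Set.Ioi (0 : ℝ), Real.exp (-s * x) * f x
      = 1 / (1 + θ * δ * (Real.sqrt (γ ^ 2 + 2 * s) - γ))) :
    Tendsto (fun x : ℝ => θ * δ * Real.sqrt (2 * Real.pi) * Real.sqrt x * f x)
      (nhdsWithin 0 (Set.Ioi 0)) (nhds 1) := by
  have hc : 0 < θ * δ := mul_pos hθ hδ
  have hint : ∀ s > 0, IntegrableOn (fun x => Real.exp (-s * x) * f x) (Set.Ioi 0) := by
    intro s hs
    refine Integrable.of_integral_ne_zero ?_
    rw [hLap s hs]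
    have : γ ≤ √(γ ^ 2 + 2 * s) := Real.le_sqrt_of_sq_le (by linarith)
    have := mul_nonneg hc.le (sub_nonneg.2 this)
    positivity
  have hlim : Tendsto (fun s => s ^ (1 / 2 : ℝ) * weightedLaplace f 1 s) atTop
      (nhds (1 / (θ * δ * √(2 * π)) * Real.Gamma (1 / 2))) := by
    have hC : 1 / (θ * δ * √(2 * π)) * Real.Gamma (1 / 2) = 1 / (θ * δ * √2) := by
      rw [Real.Gamma_one_half_eq, Real.sqrt_mul zero_le_two]
      have : 0 < √π := Real.sqrt_pos.2 Real.pi_pos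
      field_simp
    rw [hC]
    refine (tendsto_sqrt_mul_geometric_inverse_gaussian_laplace γ hc).congr' ?_
    filter_upwards [eventually_gt_atTop 0] with s hs
    rw [← hLap s hs, Real.sqrt_eq_rpow]
    simp [weightedLaplace]
  have h := (tendsto_rpow_mul_of_tendsto_laplace one_half_pos hfnn hint hfmono hlim).const_mul
    (θ * δ * √(2 * π))
  have hpos : θ * δ * √(2 * π) ≠ 0 := by positivity
  rw [mul_one_div_cancel hpos] at h
  refine h.congr fun x => ?_
  rw [Real.sqrt_eq_rpow x, mul_assoc (θ * δ * √(2 * π))]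
  norm_num
end

section
/- Define f : (0,∞) → ℝ by f(x) = 1/√(πx) − e^x · Erfc(√x), where Erfc(t) = 1 − Erf(t) is the complementary error function. Then f is nonnegative and for every s > 0, ∫_0^∞ e^{−sx} f(x) dx = 1/(1 + √s). -/
open Real MeasureTheory

/-- The error function `Erf(t) = (2/√π) ∫_0^t e^{−u²} du`. -/
noncomputable def Erf (t : ℝ) : ℝ := (2 / Real.sqrt Real.pi) * ∫ u in (0 : ℝ)..t, Real.exp (-u ^ 2)

/-- The complementary error function `Erfc(t) = 1 − Erf(t)`. -/
noncomputable def Erfc (t : ℝ) : ℝ := 1 - Erf t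

theorem hasDerivAt_Erf (t : ℝ) :
    HasDerivAt Erf (2 / Real.sqrt Real.pi * Real.exp (-t ^ 2)) t := by
  have hc : Continuous fun u : ℝ => Real.exp (-u ^ 2) := by fun_prop
  exact (intervalIntegral.integral_hasDerivAt_right (hc.intervalIntegrable 0 t)
    hc.stronglyMeasurable.stronglyMeasurableAtFilter hc.continuousAt).const_mul _

theorem continuous_Erf : Continuous Erf :=
  continuous_iff_continuousAt.2 fun t => (hasDerivAt_Erf t).continuousAt

theorem Erf_zero : Erf 0 = 0 := by simp [Erf]

theorem tendsto_Erf_atTop : Filter.Tendsto Erf Filter.atTop (nhds 1) := by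
  have hi : IntegrableOn (fun u : ℝ => Real.exp (-u ^ 2)) (Set.Ioi 0) := by
    simpa using (integrable_exp_neg_mul_sq one_pos).integrableOn (s := Set.Ioi 0)
  have h := (intervalIntegral_tendsto_integral_Ioi 0 hi Filter.tendsto_id).const_mul
    (2 / Real.sqrt Real.pi)
  have hg : ∫ u in Set.Ioi (0 : ℝ), Real.exp (-u ^ 2) = Real.sqrt Real.pi / 2 := by
    simpa using integral_gaussian_Ioi 1
  have hpi : Real.sqrt Real.pi ≠ 0 := by positivity
  rw [hg, show 2 / Real.sqrt Real.pi * (Real.sqrt Real.pi / 2) = 1 by field_simp] at h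
  exact h

theorem hasDerivAt_Erfc (t : ℝ) :
    HasDerivAt Erfc (-(2 / Real.sqrt Real.pi * Real.exp (-t ^ 2))) t :=
  (hasDerivAt_Erf t).const_sub 1

theorem continuous_Erfc : Continuous Erfc := continuous_const.sub continuous_Erf

theorem tendsto_Erfc_atTop : Filter.Tendsto Erfc Filter.atTop (nhds 0) := by
  have h := tendsto_Erf_atTop.const_sub 1
  rw [sub_self] at h
  exact h

theorem Erfc_nonneg (t : ℝ) : 0 ≤ Erfc t := by
  have hanti : Antitone Erfc := antitone_of_hasDerivAt_nonpos hasDerivAt_Erfc fun t => by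
    have : 0 ≤ 2 / Real.sqrt Real.pi * Real.exp (-t ^ 2) := by positivity
    simpa using this
  exact hanti.le_of_tendsto tendsto_Erfc_atTop t

/-- The Mills ratio bound for the Gaussian tail. -/
theorem Erfc_le {t : ℝ} (ht : 0 < t) :
    Erfc t ≤ Real.exp (-t ^ 2) / (Real.sqrt Real.pi * t) := by
  have hpi : Real.sqrt Real.pi ≠ 0 := by positivity
  set G : ℝ → ℝ := fun t => Real.exp (-t ^ 2) / (Real.sqrt Real.pi * t) - Erfc t with hG
  have hd : ∀ u > 0, HasDerivAt G (-(Real.exp (-u ^ 2) / (Real.sqrt Real.pi * u ^ 2))) u := by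
    intro u hu
    have h1 : HasDerivAt (fun u : ℝ => Real.exp (-u ^ 2)) (Real.exp (-u ^ 2) * (-(2 * u))) u := by
      simpa using ((hasDerivAt_pow 2 u).neg).exp
    have h2 : HasDerivAt (fun u : ℝ => Real.sqrt Real.pi * u) (Real.sqrt Real.pi) u := by
      simpa using (hasDerivAt_id u).const_mul (Real.sqrt Real.pi)
    refine ((h1.div h2 (by positivity)).sub (hasDerivAt_Erfc u)).congr_deriv ?_
    field_simp
    ring
  have hanti : AntitoneOn G (Set.Ioi 0) := by
    refine antitoneOn_of_hasDerivWithinAt_nonpos (convex_Ioi 0)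
      (fun u hu => (hd u hu).continuousAt.continuousWithinAt)
      (fun u hu => (hd u (by simpa using hu)).hasDerivWithinAt) fun u hu => ?_
    have hu' : 0 < u := by simpa using hu
    have : 0 ≤ Real.exp (-u ^ 2) / (Real.sqrt Real.pi * u ^ 2) := by positivity
    linarith
  have hlim : Filter.Tendsto G Filter.atTop (nhds 0) := by
    have h1 : Filter.Tendsto (fun u : ℝ => Real.exp (-u ^ 2)) Filter.atTop (nhds 0) :=
      Real.tendsto_exp_neg_atTop_nhds_zero.comp (Filter.tendsto_pow_atTop two_ne_zero)
    have h2 : Filter.Tendsto (fun u : ℝ => Real.sqrt Real.pi * u) Filter.atTop Filter.atTop :=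
      Filter.tendsto_id.const_mul_atTop (by positivity)
    have h := (h1.div_atTop h2).sub tendsto_Erfc_atTop
    rw [sub_self] at h
    exact h
  have h0 : 0 ≤ G t := le_of_tendsto hlim <| by
    filter_upwards [Filter.eventually_ge_atTop t] with u hu
    exact hanti ht (ht.trans_le hu) hu
  simpa [hG] using h0

theorem exp_mul_Erfc_sqrt_le {x : ℝ} (hx : 0 < x) :
    Real.exp x * Erfc (Real.sqrt x) ≤ 1 / Real.sqrt (Real.pi * x) := by
  have h := mul_le_mul_of_nonneg_left (Erfc_le (Real.sqrt_pos.2 hx)) (Real.exp_pos x).le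
  rwa [Real.sq_sqrt hx.le, mul_div_assoc', ← Real.exp_add, add_neg_cancel, Real.exp_zero,
    ← Real.sqrt_mul Real.pi_pos.le] at h

theorem hasDerivAt_Erf_sqrt {x : ℝ} (hx : 0 < x) :
    HasDerivAt (fun x => Erf (Real.sqrt x)) (Real.exp (-x) / Real.sqrt (Real.pi * x)) x := by
  refine ((hasDerivAt_Erf _).comp x (Real.hasDerivAt_sqrt hx.ne')).congr_deriv ?_
  rw [Real.sq_sqrt hx.le, Real.sqrt_mul Real.pi_pos.le]
  field_simp

theorem hasDerivAt_Erfc_sqrt {x : ℝ} (hx : 0 < x) :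
    HasDerivAt (fun x => Erfc (Real.sqrt x)) (-(Real.exp (-x) / Real.sqrt (Real.pi * x))) x :=
  (hasDerivAt_Erf_sqrt hx).const_sub 1

theorem tendsto_Erf_sqrt_mul_atTop {s : ℝ} (hs : 0 < s) :
    Filter.Tendsto (fun x => Erf (Real.sqrt (s * x))) Filter.atTop (nhds 1) :=
  tendsto_Erf_atTop.comp (Real.tendsto_sqrt_atTop.comp (Filter.tendsto_id.const_mul_atTop hs))

theorem integral_laplace_of_ne_one {s : ℝ} (hs : 0 < s) (hs1 : s ≠ 1) :
    ∫ x in Set.Ioi (0 : ℝ), Real.exp (-s * x) *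
      (1 / Real.sqrt (Real.pi * x) - Real.exp x * Erfc (Real.sqrt x)) = 1 / (1 + Real.sqrt s) := by
  have hs1' : 1 - s ≠ 0 := sub_ne_zero.2 hs1.symm
  have hss : Real.sqrt s * Real.sqrt s = s := Real.mul_self_sqrt hs.le
  set F : ℝ → ℝ := fun x => -(Real.sqrt s / (1 - s)) * Erf (Real.sqrt (s * x)) -
    Real.exp ((1 - s) * x) * Erfc (Real.sqrt x) / (1 - s) with hF
  have hcont : Continuous F := by
    have h1 := continuous_Erf
    have h2 := continuous_Erfc
    fun_prop
  have hexp {x : ℝ} : Real.exp ((1 - s) * x) = Real.exp (-s * x) * Real.exp x := by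
    rw [← Real.exp_add]; ring_nf
  have hlim0 : Filter.Tendsto (fun x => Real.exp ((1 - s) * x) * Erfc (Real.sqrt x))
      Filter.atTop (nhds 0) := by
    have h1 : Filter.Tendsto (fun x : ℝ => Real.exp (-s * x)) Filter.atTop (nhds 0) :=
      Real.tendsto_exp_atBot.comp (Filter.tendsto_id.const_mul_atTop_of_neg (neg_neg_of_pos hs))
    have h2 : Filter.Tendsto (fun x : ℝ => Real.sqrt (Real.pi * x)) Filter.atTop Filter.atTop :=
      Real.tendsto_sqrt_atTop.comp (Filter.tendsto_id.const_mul_atTop Real.pi_pos)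
    refine squeeze_zero' (.of_forall fun x => mul_nonneg (Real.exp_pos _).le (Erfc_nonneg _)) ?_
      (h1.div_atTop h2)
    filter_upwards [Filter.eventually_gt_atTop 0] with x hx
    rw [hexp, mul_assoc, div_eq_mul_one_div]
    exact mul_le_mul_of_nonneg_left (exp_mul_Erfc_sqrt_le hx) (Real.exp_pos _).le
  have hlim : Filter.Tendsto F Filter.atTop (nhds (-(Real.sqrt s / (1 - s)))) := by
    have h := ((tendsto_Erf_sqrt_mul_atTop hs).const_mul (-(Real.sqrt s / (1 - s)))).sub
      (hlim0.div_const (1 - s))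
    simpa [hF] using h
  rw [integral_Ioi_of_hasDerivAt_of_nonneg (g := F) hcont.continuousWithinAt ?_ ?_ hlim]
  · have h1 : 1 + Real.sqrt s ≠ 0 := by positivity
    simp only [hF, mul_zero, Real.sqrt_zero, Erf_zero, Erfc, Real.exp_zero]
    field_simp
    linear_combination -hss
  · intro x hx
    have hx : 0 < x := hx
    have h1 : HasDerivAt (fun x => Erf (Real.sqrt (s * x)))
        (Real.exp (-(s * x)) / Real.sqrt (Real.pi * (s * x)) * s) x :=
      HasDerivAt.comp (h := fun x => s * x) (h₂ := fun y => Erf (Real.sqrt y)) x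
        (hasDerivAt_Erf_sqrt (mul_pos hs hx)) (hasDerivAt_const_mul s)
    have h2 : HasDerivAt (fun x => Real.exp ((1 - s) * x))
        (Real.exp ((1 - s) * x) * (1 - s)) x := by
      simpa using ((hasDerivAt_id x).const_mul (1 - s)).exp
    refine ((h1.const_mul _).sub
      ((h2.mul (hasDerivAt_Erfc_sqrt hx)).div_const (1 - s))).congr_deriv ?_
    rw [mul_left_comm Real.pi, Real.sqrt_mul hs.le, hexp, ← neg_mul, Real.exp_neg]
    field_simp
    ring
  · intro x hx
    exact mul_nonneg (Real.exp_pos _).le (sub_nonneg.2 (exp_mul_Erfc_sqrt_le hx))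

theorem integral_laplace_one :
    ∫ x in Set.Ioi (0 : ℝ), Real.exp (-1 * x) *
      (1 / Real.sqrt (Real.pi * x) - Real.exp x * Erfc (Real.sqrt x)) = 1 / 2 := by
  set F : ℝ → ℝ := fun x => Real.sqrt x * Real.exp (-x) / Real.sqrt Real.pi +
    1 / 2 * Erf (Real.sqrt x) - x * Erfc (Real.sqrt x) with hF
  have hcont : Continuous F := by
    have h1 := continuous_Erf
    have h2 := continuous_Erfc
    fun_prop
  have hlim1 : Filter.Tendsto (fun x => Real.sqrt x * Real.exp (-x) / Real.sqrt Real.pi)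
      Filter.atTop (nhds 0) := by
    have h := (tendsto_rpow_mul_exp_neg_mul_atTop_nhds_zero (1 / 2) 1 one_pos).div_const
      (Real.sqrt Real.pi)
    simpa [Real.sqrt_eq_rpow] using h
  have hlim2 : Filter.Tendsto (fun x => x * Erfc (Real.sqrt x)) Filter.atTop (nhds 0) := by
    refine squeeze_zero' ?_ ?_ hlim1
    · filter_upwards [Filter.eventually_ge_atTop 0] with x hx
      exact mul_nonneg hx (Erfc_nonneg _)
    · filter_upwards [Filter.eventually_gt_atTop 0] with x hx
      have hx' := Real.sqrt_pos.2 hx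
      refine (mul_le_mul_of_nonneg_left (Erfc_le hx') hx.le).trans_eq ?_
      rw [Real.sq_sqrt hx.le]
      field_simp
      rw [Real.sq_sqrt hx.le]
  have hlim : Filter.Tendsto F Filter.atTop (nhds (1 / 2)) := by
    have h := (hlim1.add ((tendsto_Erf_sqrt_mul_atTop one_pos).const_mul (1 / 2))).sub hlim2
    simpa [hF] using h
  rw [integral_Ioi_of_hasDerivAt_of_nonneg (g := F) hcont.continuousWithinAt ?_ ?_ hlim]
  · simp [hF, Erf_zero]
  · intro x hx
    have hx : 0 < x := hx
    have hx' := Real.sqrt_pos.2 hx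
    have h1 : HasDerivAt (fun x : ℝ => Real.exp (-x)) (-Real.exp (-x)) x := by
      simpa using (hasDerivAt_neg x).exp
    refine (((((Real.hasDerivAt_sqrt hx.ne').mul h1).div_const _).add
      ((hasDerivAt_Erf_sqrt hx).const_mul _)).sub
      ((hasDerivAt_id x).mul (hasDerivAt_Erfc_sqrt hx))).congr_deriv ?_
    have hsq : Real.sqrt x ^ 2 = x := Real.sq_sqrt hx.le
    rw [Real.sqrt_mul Real.pi_pos.le, neg_one_mul, Real.exp_neg]
    simp only [id]
    field_simp
    rw [hsq]
    ring
  · intro x hx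
    exact mul_nonneg (Real.exp_pos _).le (sub_nonneg.2 (exp_mul_Erfc_sqrt_le hx))

/-- The density `f(x) = 1/√(πx) − e^x Erfc(√x)` of the Mittag-Leffler distribution with
index `1/2` is nonnegative and has Laplace transform `1/(1 + √s)`. -/
theorem mittag_leffler_half_density
    (f : ℝ → ℝ)
    (hf : ∀ x > (0 : ℝ), f x = 1 / Real.sqrt (Real.pi * x) - Real.exp x * Erfc (Real.sqrt x)) :
    (∀ x > (0 : ℝ), 0 ≤ f x) ∧
    ∀ s > (0 : ℝ), ∫ x in Set.Ioi (0 : ℝ), Real.exp (-s * x) * f x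
      = 1 / (1 + Real.sqrt s) := by
  refine ⟨fun x hx => ?_, fun s hs => ?_⟩
  · rw [hf x hx]
    exact sub_nonneg.2 (exp_mul_Erfc_sqrt_le hx)
  · rw [setIntegral_congr_fun measurableSet_Ioi fun x hx =>
      congrArg (Real.exp (-s * x) * ·) (hf x hx)]
    rcases eq_or_ne s 1 with rfl | hs1
    · rw [integral_laplace_one, Real.sqrt_one, one_add_one_eq_two]
    · exact integral_laplace_of_ne_one hs hs1
end
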